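/- Let n ≥ 2, let 𝒜 satisfy (H) for (k,l), and let R be a pairing relation on E = {e_1, −e_1, …, e_n, −e_n}. If the covering Â_R satisfies condition (C), then Â_R satisfies the local isomorphism property. -/

import Mathlib

namespace Folding

noncomputable section

open Set

/-- Points of `ℝ^n` with the euclidean distance. -/
abbrev Pt (n : ℕ) := EuclideanSpace ℝ (Fin n)

/-- `p` is a point of the lattice `ℤ^n`. -/
def latt {n : ℕ} (p : Pt n) : Prop := ∀ i, ∃ m : ℤ, p i = (m : ℝ)

/-- `p` belongs to `m·ℤ^n`. -/
def inLat {n : ℕ} (m : ℕ) (p : Pt n) : Prop := ∀ i, ∃ c : ℤ, p i = (m : ℝ) * (c : ℝ)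

/-- The canonical basis vector `e_i`. -/
def uvec (n : ℕ) (i : Fin n) : Pt n := EuclideanSpace.single i (1 : ℝ)

/-- `u` belongs to `E = {e_1, -e_1, …, e_n, -e_n}`. -/
def IsDir {n : ℕ} (u : Pt n) : Prop := ∃ i, u = uvec n i ∨ u = -uvec n i

/-- A (nonoriented) lattice segment `[x, x + e_i]`, as an unordered pair of endpoints. -/
def IsSeg {n : ℕ} (S : Sym2 (Pt n)) : Prop := ∃ x i, latt x ∧ S = s(x, x + uvec n i)

/-- A curve: a sequence of segments, indexed by an interval of `ℤ` (finite, ℕ-like or ℤ-like),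
recorded through its sequence of vertices; two consecutive segments have exactly one common
endpoint, and the common endpoints with the preceding and the following segments differ
(`noback`). -/
structure Curve (n : ℕ) where
  dom : Set ℤ
  ordConn : dom.OrdConnected
  nontriv : ∃ i, i ∈ dom ∧ i + 1 ∈ dom
  v : ℤ → Pt n
  lattice : ∀ i ∈ dom, latt (v i)
  step : ∀ i : ℤ, i ∈ dom → i + 1 ∈ dom →
    ∃ j, v (i + 1) = v i + uvec n j ∨ v (i + 1) = v i - uvec n j
  noback : ∀ i : ℤ, i - 1 ∈ dom → i + 1 ∈ dom → v (i + 1) ≠ v (i - 1)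

namespace Curve

variable {n : ℕ} (c : Curve n)

/-- The segments of a curve. -/
def segs : Set (Sym2 (Pt n)) :=
  {S | ∃ i : ℤ, i ∈ c.dom ∧ i + 1 ∈ c.dom ∧ S = s(c.v i, c.v (i + 1))}

/-- The connexions between segments of a curve: pairs of consecutive segments. -/
def conn (S T : Sym2 (Pt n)) : Prop :=
  ∃ i : ℤ, i - 1 ∈ c.dom ∧ i + 1 ∈ c.dom ∧
    ((S = s(c.v (i - 1), c.v i) ∧ T = s(c.v i, c.v (i + 1))) ∨
     (T = s(c.v (i - 1), c.v i) ∧ S = s(c.v i, c.v (i + 1))))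

/-- A curve is self-avoiding if each of its segments appears only once. -/
def SelfAvoiding : Prop :=
  ∀ i j : ℤ, i ∈ c.dom → i + 1 ∈ c.dom → j ∈ c.dom → j + 1 ∈ c.dom →
    s(c.v i, c.v (i + 1)) = s(c.v j, c.v (j + 1)) → i = j

/-- A curve without endpoints (indexed by `ℤ`). -/
def NoEndpts : Prop := c.dom = Set.univ

/-- `p` is an endpoint of the curve `c`. -/
def IsEndpt (p : Pt n) : Prop :=
  ∃ i ∈ c.dom, p = c.v i ∧ (i - 1 ∉ c.dom ∨ i + 1 ∉ c.dom)

/-- `S` is the end segment of `c` at its endpoint `p`. -/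
def endSegAt (p : Pt n) (S : Sym2 (Pt n)) : Prop :=
  ∃ i : ℤ, i ∈ c.dom ∧ p = c.v i ∧
    ((i - 1 ∉ c.dom ∧ i + 1 ∈ c.dom ∧ S = s(c.v i, c.v (i + 1))) ∨
     (i + 1 ∉ c.dom ∧ i - 1 ∈ c.dom ∧ S = s(c.v (i - 1), c.v i)))

/-- The number of segments (length) of a curve. -/
def nsegs : ℕ := {i : ℤ | i ∈ c.dom ∧ i + 1 ∈ c.dom}.ncard

end Curve

/-- The trace of a set of curves: its set of segments together with the connexion
relation between segments.  Two sets of curves are geometrically the same set of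
(nonoriented) curves iff they have the same trace. -/
structure Trace (n : ℕ) where
  segs : Set (Sym2 (Pt n))
  conn : Sym2 (Pt n) → Sym2 (Pt n) → Prop

def curveTrace {n : ℕ} (c : Curve n) : Trace n := ⟨c.segs, c.conn⟩

def traceOf {n : ℕ} (E : Set (Curve n)) : Trace n :=
  ⟨{S | ∃ c ∈ E, S ∈ c.segs}, fun S T => ∃ c ∈ E, c.conn S T⟩

/-- Two curves are the same nonoriented curve. -/
def SameCurve {n : ℕ} (c d : Curve n) : Prop := c.segs = d.segs ∧ c.conn = d.conn

/-- A set of pairwise disjoint self-avoiding curves. -/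
def DisjSA {n : ℕ} (E : Set (Curve n)) : Prop :=
  (∀ c ∈ E, c.SelfAvoiding) ∧
  ∀ c ∈ E, ∀ d ∈ E, ¬ SameCurve c d → ∀ S, S ∈ c.segs → S ∉ d.segs

/-- The set of points of `ℝ^n` lying on the segment `S`. -/
def segPts {n : ℕ} (S : Sym2 (Pt n)) : Set (Pt n) :=
  {p | ∃ a b, S = s(a, b) ∧ ∃ t : ℝ, 0 ≤ t ∧ t ≤ 1 ∧ p = a + t • (b - a)}

def Trace.pts {n : ℕ} (T : Trace n) : Set (Pt n) := ⋃ S ∈ T.segs, segPts S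

/-- A set of curves covers `X ⊆ ℝ^n`: each lattice segment containing a point of `X`
appears in one and only one of the curves. -/
def Covers {n : ℕ} (E : Set (Curve n)) (X : Set (Pt n)) : Prop :=
  ∀ S, IsSeg S → (segPts S ∩ X).Nonempty →
    (∃ c ∈ E, S ∈ c.segs) ∧ ∀ c ∈ E, ∀ d ∈ E, S ∈ c.segs → S ∈ d.segs → SameCurve c d

/-- A covering of `ℝ^n` by disjoint self-avoiding curves. -/
def IsCovering {n : ℕ} (E : Set (Curve n)) : Prop := DisjSA E ∧ Covers E Set.univ

/-- A single curve covers `X`. -/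
def CurveCovers {n : ℕ} (c : Curve n) (X : Set (Pt n)) : Prop :=
  ∀ S, IsSeg S → (segPts S ∩ X).Nonempty → S ∈ c.segs

/-- `b` is a curve contained in the curve `a`. -/
def SubCurve {n : ℕ} (b a : Curve n) : Prop :=
  b.segs ⊆ a.segs ∧ ∀ S T, b.conn S T → a.conn S T

/-- The relation `≺` at the level of traces. -/
def TPrec {n : ℕ} (T T' : Trace n) : Prop :=
  T.segs ⊆ T'.segs ∧ ∀ S S', T.conn S S' → T'.conn S S'

/-- `E ≺ F` : each segment of a curve of `E` is a segment of a curve of `F` and each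
connexion between two segments of a curve of `E` also exists in `F`. -/
def Prec {n : ℕ} (E F : Set (Curve n)) : Prop := TPrec (traceOf E) (traceOf F)

/-- Image of a trace under a map of `ℝ^n`. -/
def Trace.map {n : ℕ} (f : Pt n → Pt n) (T : Trace n) : Trace n :=
  ⟨Sym2.map f '' T.segs,
   fun S S' => ∃ A B, T.conn A B ∧ S = Sym2.map f A ∧ S' = Sym2.map f B⟩

/-- Translation of a trace by the vector `t`. -/
def Trace.transl {n : ℕ} (t : Pt n) (T : Trace n) : Trace n := T.map (fun p => p + t)

/-- Property (H) for the pair `(k, l)`. -/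
def SatH {n : ℕ} (A : Set (Curve n)) (k l : ℕ) : Prop :=
  0 < k ∧ 0 < l ∧ k ∣ l ∧ IsCovering A ∧
  (∀ c ∈ A, c.dom.Finite ∧ ∃ x i, latt x ∧ inLat k x ∧ c.IsEndpt x ∧
      c.IsEndpt (x + (k : ℝ) • uvec n i) ∧
      ∀ p, c.IsEndpt p → p = x ∨ p = x + (k : ℝ) • uvec n i) ∧
  (∀ (x : Pt n) (i : Fin n), latt x → inLat k x →
      (∃ c ∈ A, c.IsEndpt x ∧ c.IsEndpt (x + (k : ℝ) • uvec n i)) ∧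
      ∀ c ∈ A, ∀ d ∈ A, c.IsEndpt x → c.IsEndpt (x + (k : ℝ) • uvec n i) →
        d.IsEndpt x → d.IsEndpt (x + (k : ℝ) • uvec n i) → SameCurve c d) ∧
  (∀ t : Pt n, inLat l t → Trace.transl t (traceOf A) = traceOf A)

/-- The trace of the convolution product `A ∗ B`, where `A` satisfies (H) for `(k, l)`:
apply to `B` the homothety of center `0` and ratio `k`, then replace each resulting
segment by the curve of `A` having the same endpoints (connexions come from the curves
of `A`, together with the junctions of the end segments of consecutive `A`-curves). -/
def ConvTrace {n : ℕ} (k : ℕ) (A B : Set (Curve n)) : Trace n where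
  segs := {S | ∃ a b : Pt n, s(a, b) ∈ (traceOf B).segs ∧
    ∃ c ∈ A, c.IsEndpt ((k : ℝ) • a) ∧ c.IsEndpt ((k : ℝ) • b) ∧ S ∈ c.segs}
  conn := fun S S' =>
    (∃ a b : Pt n, s(a, b) ∈ (traceOf B).segs ∧
      ∃ c ∈ A, c.IsEndpt ((k : ℝ) • a) ∧ c.IsEndpt ((k : ℝ) • b) ∧ c.conn S S') ∨
    (∃ a b d : Pt n, (traceOf B).conn s(a, b) s(b, d) ∧
      ∃ c ∈ A, ∃ c' ∈ A, c.IsEndpt ((k : ℝ) • a) ∧ c.IsEndpt ((k : ℝ) • b) ∧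
        c'.IsEndpt ((k : ℝ) • b) ∧ c'.IsEndpt ((k : ℝ) • d) ∧
        ((c.endSegAt ((k : ℝ) • b) S ∧ c'.endSegAt ((k : ℝ) • b) S') ∨
         (c.endSegAt ((k : ℝ) • b) S' ∧ c'.endSegAt ((k : ℝ) • b) S)))

/-- The two-sided identity of the convolution product: the covering consisting of all
curves with one segment. -/
def unitTrace (n : ℕ) : Trace n := ⟨{S | IsSeg S}, fun _ _ => False⟩

/-- `P s` realizes the power `A^s` for the convolution product. -/
def PowersOf {n : ℕ} (A : Set (Curve n)) (k : ℕ) (P : ℕ → Set (Curve n)) : Prop :=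
  (∀ s, DisjSA (P s)) ∧ traceOf (P 0) = unitTrace n ∧
  ∀ s, traceOf (P (s + 1)) = ConvTrace k A (P s)

/-- The trace of `Â`, the inductive limit of the `A^s` for `≺`. -/
def hatTrace {n : ℕ} (P : ℕ → Set (Curve n)) : Trace n :=
  ⟨{S | ∃ s, S ∈ (traceOf (P s)).segs}, fun S T => ∃ s, (traceOf (P s)).conn S T⟩

/-- A pairing relation on `E = {e_1, -e_1, …, e_n, -e_n}`. -/
def IsPairing {n : ℕ} (R : Pt n → Pt n → Prop) : Prop :=
  (∀ u v, R u v → R v u) ∧ (∀ u v, R u v → IsDir u ∧ IsDir v) ∧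
  (∀ u, ¬ R u u) ∧ ∀ u, IsDir u → ∃! v, R u v

/-- The trace of `Â_R` : `Â` with the segments with endpoint `0` connected according
to `R`. -/
def hatRTrace {n : ℕ} (P : ℕ → Set (Curve n)) (R : Pt n → Pt n → Prop) : Trace n :=
  ⟨(hatTrace P).segs,
   fun S T => (hatTrace P).conn S T ∨
     ∃ u v, R u v ∧ S = s((0 : Pt n), u) ∧ T = s((0 : Pt n), v)⟩

/-- The cube `P_{x,h}`. -/
def cube {n : ℕ} (x : Pt n) (h : ℕ) : Set (Pt n) :=
  {p | ∀ i, x i - h ≤ p i ∧ p i ≤ x i + h}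

/-- Restriction of a trace to a region `X` of `ℝ^n`. -/
def Trace.restr {n : ℕ} (T : Trace n) (X : Set (Pt n)) : Trace n :=
  ⟨{S | S ∈ T.segs ∧ segPts S ⊆ X},
   fun S S' => T.conn S S' ∧ segPts S ⊆ X ∧ segPts S' ⊆ X⟩

/-- Condition (C). -/
def CondC {n : ℕ} (T : Trace n) : Prop :=
  ∀ (x : Pt n) (h : ℕ), latt x → 1 ≤ h →
    ∃ y : Pt n, latt y ∧ y ∉ cube x h ∧
      Trace.transl (y - x) (T.restr (cube x h)) = T.restr (cube y h)

/-- `(B(x,r) ∩ T, x) ≅ (B(y,r) ∩ T', y)` : the translation sending `x` to `y` maps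
the part of `T` in the closed ball `B(x,r)` onto the part of `T'` in `B(y,r)`,
preserving the connexions between segments. -/
def BallIso {n : ℕ} (T : Trace n) (x : Pt n) (T' : Trace n) (y : Pt n) (r : ℝ) : Prop :=
  (fun p => p + (y - x)) '' (T.pts ∩ Metric.closedBall x r) =
      T'.pts ∩ Metric.closedBall y r ∧
  (∀ S S', T.conn S S' → segPts S ⊆ Metric.closedBall x r →
      segPts S' ⊆ Metric.closedBall x r →
      T'.conn (Sym2.map (fun p => p + (y - x)) S) (Sym2.map (fun p => p + (y - x)) S')) ∧
  (∀ S S', T'.conn S S' → segPts S ⊆ Metric.closedBall y r →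
      segPts S' ⊆ Metric.closedBall y r →
      T.conn (Sym2.map (fun p => p + (x - y)) S) (Sym2.map (fun p => p + (x - y)) S'))

/-- The local isomorphism property. -/
def LocIsoProp {n : ℕ} (T : Trace n) : Prop :=
  ∀ (x : Pt n) (r : ℝ), 0 ≤ r →
    ∃ t : ℝ, 0 ≤ t ∧ ∀ y : Pt n, ∃ z ∈ Metric.closedBall y t, BallIso T x T z r

/-- Two traces are locally isomorphic. -/
def LocallyIso {n : ℕ} (T T' : Trace n) : Prop :=
  (∀ (x : Pt n) (r : ℝ), 0 ≤ r → ∃ y, BallIso T x T' y r) ∧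
  (∀ (y : Pt n) (r : ℝ), 0 ≤ r → ∃ x, BallIso T' y T x r)

/-- `Ω_{s,x}` : suppress the connexions between segments whose common endpoint lies in
`x + k^s ℤ^n`. -/
def OmegaTrace {n : ℕ} (k s : ℕ) (x : Pt n) (T : Trace n) : Trace n :=
  ⟨T.segs, fun S S' => T.conn S S' ∧ ¬ ∃ p, p ∈ S ∧ p ∈ S' ∧ inLat (k ^ s) (p - x)⟩

/-- `Σ_{s,x}(E)` : for each curve `D` of `E` passing through `x`, the curve(s) with
endpoint `x` contained in `D` having maximal length, this length being limited to
`8^s`. -/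
def SigmaSet {n : ℕ} (s : ℕ) (x : Pt n) (E : Set (Curve n)) : Set (Curve n) :=
  {b | ∃ D ∈ E, SubCurve b D ∧ b.IsEndpt x ∧ b.nsegs ≤ 8 ^ s ∧
    ∀ b' : Curve n, SubCurve b' D → b'.IsEndpt x → b'.nsegs ≤ 8 ^ s →
      SubCurve b b' → SameCurve b b'}

/-- A positive (orientation preserving) isometry of `ℝ^n`. -/
def PosIsom {n : ℕ} (f : Pt n → Pt n) : Prop :=
  ∃ (g : Pt n ≃ₗᵢ[ℝ] Pt n) (t : Pt n), (∀ x, f x = g x + t) ∧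
    0 < LinearMap.det (g.toLinearEquiv.toLinearMap)

/-- `E` consists of exactly `m` curves. -/
def HasExactly {n : ℕ} (E : Set (Curve n)) (m : ℕ) : Prop :=
  ∃ L : List (Curve n), L.length = m ∧ (∀ c ∈ L, c ∈ E) ∧
    L.Pairwise (fun c d => ¬ SameCurve c d) ∧ ∀ c ∈ E, ∃ d ∈ L, SameCurve c d

/-- `E` consists of at most `m` curves. -/
def AtMost {n : ℕ} (E : Set (Curve n)) (m : ℕ) : Prop :=
  ∃ L : List (Curve n), L.length ≤ m ∧ ∀ c ∈ E, ∃ d ∈ L, SameCurve c d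

/-- The set of points of a curve. -/
def curvePts {n : ℕ} (c : Curve n) : Set (Pt n) := ⋃ S ∈ c.segs, segPts S


section Shift

variable {n : ℕ}

/-- The translate of an unordered pair of points by the vector `t`. -/
abbrev shift (t : Pt n) (S : Sym2 (Pt n)) : Sym2 (Pt n) := Sym2.map (fun p => p + t) S

theorem shift_shift (s t : Pt n) (S : Sym2 (Pt n)) :
    shift s (shift t S) = shift (t + s) S := by
  induction S with
  | _ a b => simp [add_assoc]

theorem shift_zero (S : Sym2 (Pt n)) : shift 0 S = S := by
  induction S with
  | _ a b => simp

theorem shift_neg_shift (t : Pt n) (S : Sym2 (Pt n)) : shift (-t) (shift t S) = S := by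
  rw [shift_shift, add_neg_cancel, shift_zero]

theorem shift_shift_neg (t : Pt n) (S : Sym2 (Pt n)) : shift t (shift (-t) S) = S := by
  rw [shift_shift, neg_add_cancel, shift_zero]

theorem mem_shift {t p : Pt n} {S : Sym2 (Pt n)} : p ∈ shift t S ↔ p - t ∈ S := by
  induction S with
  | _ a b => simp [sub_eq_iff_eq_add]

theorem mem_segPts {p : Pt n} {S : Sym2 (Pt n)} (h : p ∈ S) : p ∈ segPts S := by
  obtain ⟨q, rfl⟩ := h
  exact ⟨p, q, rfl, 0, le_rfl, zero_le_one, by simp⟩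

theorem segPts_shift_of_mem {t q : Pt n} {S : Sym2 (Pt n)} (h : q ∈ segPts S) :
    q + t ∈ segPts (shift t S) := by
  obtain ⟨a, b, rfl, u, h0, h1, rfl⟩ := h
  refine ⟨a + t, b + t, by simp, u, h0, h1, ?_⟩
  rw [add_sub_add_right_eq_sub]
  abel

theorem mem_segPts_shift {t q : Pt n} {S : Sym2 (Pt n)} :
    q ∈ segPts (shift t S) ↔ q - t ∈ segPts S := by
  constructor
  · intro h
    have := segPts_shift_of_mem (t := -t) h
    rwa [shift_neg_shift, ← sub_eq_add_neg] at this
  · intro h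
    simpa using segPts_shift_of_mem (t := t) h

theorem segPts_pair_subset_of_convex {X : Set (Pt n)} (hX : Convex ℝ X) {a b : Pt n}
    (ha : a ∈ X) (hb : b ∈ X) : segPts s(a, b) ⊆ X := by
  rintro p ⟨c, d, hcd, t, h0, h1, rfl⟩
  have hc : c ∈ X ∧ d ∈ X := by
    rcases Sym2.eq_iff.1 hcd with ⟨rfl, rfl⟩ | ⟨rfl, rfl⟩
    · exact ⟨ha, hb⟩
    · exact ⟨hb, ha⟩
  exact hX.add_smul_sub_mem hc.1 hc.2 ⟨h0, h1⟩

theorem latt_zero : latt (0 : Pt n) := fun _ => ⟨0, by simp⟩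

theorem latt.add {p q : Pt n} (hp : latt p) (hq : latt q) : latt (p + q) := fun i => by
  obtain ⟨a, ha⟩ := hp i
  obtain ⟨b, hb⟩ := hq i
  exact ⟨a + b, by simp [ha, hb]⟩

theorem latt.neg {p : Pt n} (hp : latt p) : latt (-p) := fun i => by
  obtain ⟨a, ha⟩ := hp i
  exact ⟨-a, by simp [ha]⟩

theorem latt.sub {p q : Pt n} (hp : latt p) (hq : latt q) : latt (p - q) :=
  sub_eq_add_neg p q ▸ hp.add hq.neg

theorem latt_uvec (i : Fin n) : latt (uvec n i) := fun j => by
  by_cases h : j = i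
  · exact ⟨1, by simp [uvec, h]⟩
  · exact ⟨0, by simp [uvec, h]⟩

theorem uvec_ne_zero (i : Fin n) : uvec n i ≠ 0 := by
  simp [uvec]

theorem inLat_one {p : Pt n} : inLat 1 p ↔ latt p := by
  simp [inLat, latt]

theorem inLat.latt {m : ℕ} {p : Pt n} (h : inLat m p) : latt p := fun i => by
  obtain ⟨c, hc⟩ := h i
  exact ⟨m * c, by simp [hc]⟩

theorem inLat.neg {m : ℕ} {p : Pt n} (h : inLat m p) : inLat m (-p) := fun i => by
  obtain ⟨c, hc⟩ := h i
  exact ⟨-c, by simp [hc]⟩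

theorem inLat.of_dvd {m m' : ℕ} (hm : m ∣ m') {p : Pt n} (h : inLat m' p) : inLat m p :=
  fun i => by
    obtain ⟨c, hc⟩ := h i
    obtain ⟨d, rfl⟩ := hm
    exact ⟨d * c, by rw [hc]; push_cast; ring⟩

theorem inLat.exists_smul {k m : ℕ} {p : Pt n} (hk : 0 < k) (h : inLat (k * m) p) :
    ∃ q, inLat m q ∧ p = (k : ℝ) • q := by
  have hk' : (k : ℝ) ≠ 0 := by exact_mod_cast hk.ne'
  refine ⟨(k : ℝ)⁻¹ • p, fun i => ?_, by rw [smul_inv_smul₀ hk']⟩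
  obtain ⟨c, hc⟩ := h i
  refine ⟨c, ?_⟩
  simp only [PiLp.smul_apply, smul_eq_mul, hc]
  push_cast
  field_simp

theorem inLat.smul {k m : ℕ} {p : Pt n} (h : inLat m p) : inLat (k * m) ((k : ℝ) • p) :=
  fun i => by
    obtain ⟨c, hc⟩ := h i
    exact ⟨c, by simp [hc, mul_assoc]⟩

theorem IsSeg.shift {t : Pt n} (ht : latt t) {S : Sym2 (Pt n)} (hS : IsSeg S) :
    IsSeg (shift t S) := by
  obtain ⟨x, i, hx, rfl⟩ := hS
  exact ⟨x + t, i, hx.add ht, by simp [add_right_comm]⟩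

end Shift

namespace Curve

variable {n : ℕ} {c d : Curve n}

theorem v_ne_succ {i : ℤ} (hi : i ∈ c.dom) (hi' : i + 1 ∈ c.dom) : c.v i ≠ c.v (i + 1) := by
  obtain ⟨j, h | h⟩ := c.step i hi hi' <;> rw [h]
  · simp [uvec_ne_zero]
  · exact fun h => uvec_ne_zero j (sub_eq_self.1 h.symm)

theorem isSeg_of_mem {S : Sym2 (Pt n)} (hS : S ∈ c.segs) : IsSeg S := by
  obtain ⟨i, hi, hi', rfl⟩ := hS
  obtain ⟨j, h | h⟩ := c.step i hi hi'
  · exact ⟨c.v i, j, c.lattice i hi, by rw [h]⟩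
  · exact ⟨c.v (i + 1), j, c.lattice _ hi', by rw [h, sub_add_cancel, Sym2.eq_swap]⟩

theorem mem_dom_of_between {i j m : ℤ} (hi : i ∈ c.dom) (hj : j ∈ c.dom) (h : i ≤ m)
    (h' : m ≤ j) : m ∈ c.dom :=
  c.ordConn.out hi hj ⟨h, h'⟩

theorem conn.symm {S T : Sym2 (Pt n)} (h : c.conn S T) : c.conn T S := by
  obtain ⟨i, hi, hi', h⟩ := h
  exact ⟨i, hi, hi', h.symm⟩

theorem conn.left_mem {S T : Sym2 (Pt n)} (h : c.conn S T) : S ∈ c.segs := by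
  obtain ⟨i, hi, hi', ⟨rfl, rfl⟩ | ⟨rfl, rfl⟩⟩ := h
  · exact ⟨i - 1, hi, mem_dom_of_between hi hi' (by omega) (by omega), by rw [sub_add_cancel]⟩
  · exact ⟨i, mem_dom_of_between hi hi' (by omega) (by omega), hi', rfl⟩

theorem conn.right_mem {S T : Sym2 (Pt n)} (h : c.conn S T) : T ∈ c.segs := h.symm.left_mem

theorem conn.exists_vertex {S T : Sym2 (Pt n)} (h : c.conn S T) :
    ∃ p, latt p ∧ p ∈ S ∧ p ∈ T := by
  obtain ⟨i, hi, hi', h⟩ := h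
  refine ⟨c.v i, c.lattice i (mem_dom_of_between hi hi' (by omega) (by omega)), ?_⟩
  rcases h with ⟨rfl, rfl⟩ | ⟨rfl, rfl⟩ <;> simp

theorem conn_of_mem {i : ℤ} (hi : i - 1 ∈ c.dom) (hi' : i + 1 ∈ c.dom) :
    c.conn s(c.v (i - 1), c.v i) s(c.v i, c.v (i + 1)) :=
  ⟨i, hi, hi', Or.inl ⟨rfl, rfl⟩⟩

theorem SelfAvoiding.conn_ne (hc : c.SelfAvoiding) {S T : Sym2 (Pt n)} (h : c.conn S T) :
    S ≠ T := by
  obtain ⟨i, hi, hi', h⟩ := h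
  have hm : i ∈ c.dom := mem_dom_of_between hi hi' (by omega) (by omega)
  have key : s(c.v (i - 1), c.v i) ≠ s(c.v i, c.v (i + 1)) := by
    intro he
    have := hc (i - 1) i hi (by simpa using hm) hm hi' (by simpa using he)
    omega
  rcases h with ⟨rfl, rfl⟩ | ⟨rfl, rfl⟩
  · exact key
  · exact key.symm

theorem SelfAvoiding.eq_vertex (hc : c.SelfAvoiding) {i : ℤ} (hi : i - 1 ∈ c.dom)
    (hi' : i + 1 ∈ c.dom) {p : Pt n} (hp : p ∈ s(c.v (i - 1), c.v i))
    (hp' : p ∈ s(c.v i, c.v (i + 1))) : p = c.v i := by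
  by_contra hne
  exact hc.conn_ne (conn_of_mem hi hi')
    (Sym2.eq_of_ne_mem hne hp (by simp) hp' (by simp))

theorem SelfAvoiding.conn_unique (hc : c.SelfAvoiding) {S V W : Sym2 (Pt n)} {p : Pt n}
    (hV : c.conn S V) (hW : c.conn S W) (hpS : p ∈ S) (hpV : p ∈ V) (hpW : p ∈ W) :
    V = W := by
  obtain ⟨i, hi, hi', hV⟩ := hV
  obtain ⟨j, hj, hj', hW⟩ := hW
  have hmi : i ∈ c.dom := mem_dom_of_between hi hi' (by omega) (by omega)
  have hmj : j ∈ c.dom := mem_dom_of_between hj hj' (by omega) (by omega)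
  rcases hV with ⟨hS, rfl⟩ | ⟨rfl, hS⟩ <;> rcases hW with ⟨hS', rfl⟩ | ⟨rfl, hS'⟩
  · have := hc (i - 1) (j - 1) hi (by simpa using hmi) hj (by simpa using hmj)
      (by simpa [← hS] using hS')
    obtain rfl : i = j := by omega
    rfl
  · have h := hc (i - 1) j hi (by simpa using hmi) hmj hj' (by simpa [← hS] using hS')
    have h1 := hc.eq_vertex hi hi' (hS ▸ hpS) hpV
    have h2 := hc.eq_vertex hj hj' hpW (hS' ▸ hpS)
    obtain rfl : i = j + 1 := by omega
    exact absurd (h2.symm.trans h1) (v_ne_succ hmj hj')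
  · have h := hc i (j - 1) hmi hi' hj (by simpa using hmj) (by simpa [← hS] using hS')
    have h1 := hc.eq_vertex hi hi' hpV (hS ▸ hpS)
    have h2 := hc.eq_vertex hj hj' (hS' ▸ hpS) hpW
    obtain rfl : j = i + 1 := by omega
    exact absurd (h1.symm.trans h2) (v_ne_succ hmi hi')
  · have := hc i j hmi hi' hmj hj' (by rw [← hS, hS'])
    rw [this]

/-- A property of segments which propagates along the connexions of a curve holds for all its
segments as soon as it holds for one of them. -/
theorem forall_segs_of_conn {Q : Sym2 (Pt n) → Prop}
    (hQ : ∀ S T, c.conn S T → Q S → Q T) {S₀ : Sym2 (Pt n)} (hS₀ : S₀ ∈ c.segs) (h₀ : Q S₀) :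
    ∀ S ∈ c.segs, Q S := by
  obtain ⟨i, hi, hi', rfl⟩ := hS₀
  rintro _ ⟨j, hj, hj', rfl⟩
  rcases le_total i j with hij | hij
  · induction j, hij using Int.leInduction with
    | base => exact h₀
    | succ m hm ih =>
      have hm1 : m ∈ c.dom := mem_dom_of_between hi hj hm (by omega)
      have h := conn_of_mem (c := c) (i := m + 1) (by simpa using hm1) hj'
      rw [add_sub_cancel_right] at h
      exact hQ _ _ h (ih hm1 hj)
  · induction j, hij using Int.leInductionDown with
    | base => exact h₀
    | pred m hm ih =>
      have hj'' : m ∈ c.dom := by simpa using hj'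
      have hm1 : m + 1 ∈ c.dom := mem_dom_of_between hj hi' (by omega) (by omega)
      have h := (conn_of_mem (c := c) hj hm1).symm
      rw [sub_add_cancel]
      exact hQ _ _ h (ih hj'' hm1)

theorem SelfAvoiding.endSegAt_iff (hc : c.SelfAvoiding) {p : Pt n} {S : Sym2 (Pt n)} :
    c.endSegAt p S ↔ S ∈ c.segs ∧ p ∈ S ∧ ∀ T, c.conn S T → p ∉ T := by
  constructor
  · rintro ⟨i, hi, rfl, ⟨hi1, hi2, rfl⟩ | ⟨hi1, hi2, rfl⟩⟩
    · refine ⟨⟨i, hi, hi2, rfl⟩, by simp, ?_⟩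
      rintro T ⟨j, hj, hj', ⟨hS, rfl⟩ | ⟨rfl, hS⟩⟩ hp
      · have hmj : j ∈ c.dom := mem_dom_of_between hj hj' (by omega) (by omega)
        have h := hc i (j - 1) hi hi2 hj (by simpa using hmj) (by simpa using hS)
        have h2 := hc.eq_vertex hj hj' (hS ▸ (by simp)) hp
        obtain rfl : j = i + 1 := by omega
        exact v_ne_succ hi hi2 h2
      · have hmj : j ∈ c.dom := mem_dom_of_between hj hj' (by omega) (by omega)
        have h := hc i j hi hi2 hmj hj' hS
        exact hi1 (h ▸ hj)
    · refine ⟨⟨i - 1, hi2, by simpa using hi, by rw [sub_add_cancel]⟩, by simp, ?_⟩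
      rintro T ⟨j, hj, hj', ⟨hS, rfl⟩ | ⟨rfl, hS⟩⟩ hp
      · have hmj : j ∈ c.dom := mem_dom_of_between hj hj' (by omega) (by omega)
        have h := hc (i - 1) (j - 1) hi2 (by simpa using hi) hj (by simpa using hmj)
          (by simpa using hS)
        obtain rfl : i = j := by omega
        exact hi1 hj'
      · have hmj : j ∈ c.dom := mem_dom_of_between hj hj' (by omega) (by omega)
        have h := hc (i - 1) j hi2 (by simpa using hi) hmj hj' (by simpa using hS)
        have h2 := hc.eq_vertex hj hj' hp (hS ▸ (by simp))
        obtain rfl : i = j + 1 := by omega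
        exact v_ne_succ hmj hj' h2.symm
  · rintro ⟨⟨i, hi, hi', rfl⟩, hp, hT⟩
    rcases Sym2.mem_iff.1 hp with rfl | rfl
    · refine ⟨i, hi, rfl, Or.inl ⟨fun h => ?_, hi', rfl⟩⟩
      exact hT _ (conn_of_mem h hi').symm (by simp)
    · refine ⟨i + 1, hi', rfl, Or.inr ⟨fun h => ?_, by simpa using hi, by simp⟩⟩
      have h' := conn_of_mem (c := c) (i := i + 1) (by simpa using hi) h
      rw [add_sub_cancel_right] at h'
      exact hT _ h' (by simp)

theorem isEndpt_iff_exists_endSegAt {p : Pt n} : c.IsEndpt p ↔ ∃ S, c.endSegAt p S := by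
  constructor
  · rintro ⟨i, hi, rfl, h⟩
    obtain ⟨j, hj, hj'⟩ := c.nontriv
    by_cases h1 : i + 1 ∈ c.dom
    · exact ⟨_, i, hi, rfl, Or.inl ⟨h.resolve_right (not_not.2 h1), h1, rfl⟩⟩
    · refine ⟨_, i, hi, rfl, Or.inr ⟨h1, ?_, rfl⟩⟩
      have hji : j + 1 ≤ i := by
        by_contra hlt
        exact h1 (mem_dom_of_between hi hj' (by omega) (by omega))
      exact mem_dom_of_between hj hi (by omega) (by omega)
  · rintro ⟨S, i, hi, rfl, ⟨h, -⟩ | ⟨h, -⟩⟩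
    · exact ⟨i, hi, rfl, Or.inl h⟩
    · exact ⟨i, hi, rfl, Or.inr h⟩

theorem endSegAt.isEndpt {p : Pt n} {S : Sym2 (Pt n)} (h : c.endSegAt p S) : c.IsEndpt p :=
  isEndpt_iff_exists_endSegAt.2 ⟨S, h⟩

end Curve

theorem SameCurve.isEndpt {n : ℕ} {c d : Curve n} (h : SameCurve c d) (hc : c.SelfAvoiding)
    (hd : d.SelfAvoiding) {p : Pt n} (hp : c.IsEndpt p) : d.IsEndpt p := by
  obtain ⟨S, hS⟩ := Curve.isEndpt_iff_exists_endSegAt.1 hp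
  rw [hc.endSegAt_iff, h.1, h.2, ← hd.endSegAt_iff] at hS
  exact hS.isEndpt

namespace DisjSA

variable {n : ℕ} {E : Set (Curve n)}

theorem sameCurve (hE : DisjSA E) {c d : Curve n} (hc : c ∈ E) (hd : d ∈ E)
    {S : Sym2 (Pt n)} (hSc : S ∈ c.segs) (hSd : S ∈ d.segs) : SameCurve c d := by
  by_contra h
  exact hE.2 c hc d hd h S hSc hSd

theorem conn_of_mem_segs (hE : DisjSA E) {c : Curve n} (hc : c ∈ E) {S T : Sym2 (Pt n)}
    (hS : S ∈ c.segs) (h : (traceOf E).conn S T) : c.conn S T := by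
  obtain ⟨d, hd, h⟩ := h
  rw [(hE.sameCurve hc hd hS h.left_mem).2]
  exact h

theorem conn_unique (hE : DisjSA E) {S V W : Sym2 (Pt n)} {p : Pt n}
    (hV : (traceOf E).conn S V) (hW : (traceOf E).conn S W) (hpS : p ∈ S) (hpV : p ∈ V)
    (hpW : p ∈ W) : V = W := by
  obtain ⟨c, hc, hV⟩ := hV
  exact (hE.1 c hc).conn_unique hV (hE.conn_of_mem_segs hc hV.left_mem hW) hpS hpV hpW

end DisjSA

theorem Trace.conn_shift_of_transl_eq {n : ℕ} {T : Trace n} {t : Pt n}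
    (h : T.transl t = T) {U V : Sym2 (Pt n)} (hUV : T.conn U V) :
    T.conn (shift t U) (shift t V) := by
  rw [← h]
  exact ⟨U, V, hUV, rfl, rfl⟩

namespace SatH

variable {n : ℕ} {A : Set (Curve n)} {k l : ℕ}

theorem disjSA (hA : SatH A k l) : DisjSA A := hA.2.2.2.1.1

theorem exists_curve_of_isSeg (hA : SatH A k l) {S : Sym2 (Pt n)} (hS : IsSeg S) :
    ∃ c ∈ A, S ∈ c.segs := by
  refine (hA.2.2.2.1.2 S hS ?_).1
  obtain ⟨x, i, -, rfl⟩ := hS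
  exact ⟨x, mem_segPts (by simp), trivial⟩

theorem exists_endpts (hA : SatH A k l) {c : Curve n} (hc : c ∈ A) :
    ∃ a b, IsSeg s(a, b) ∧ c.IsEndpt ((k : ℝ) • a) ∧ c.IsEndpt ((k : ℝ) • b) ∧
      ∀ p, c.IsEndpt p → p = (k : ℝ) • a ∨ p = (k : ℝ) • b := by
  obtain ⟨-, x, i, -, hx, h1, h2, h3⟩ := hA.2.2.2.2.1 c hc
  obtain ⟨q, hq, rfl⟩ := inLat.exists_smul (m := 1) hA.1 (by simpa using hx)
  rw [← smul_add] at h2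
  refine ⟨q, q + uvec n i, ⟨q, i, hq.latt, rfl⟩, h1, h2, fun p hp => ?_⟩
  simpa [smul_add] using h3 p hp

theorem exists_curve_of_endpts (hA : SatH A k l) {a b : Pt n} (hab : IsSeg s(a, b)) :
    ∃ c ∈ A, c.IsEndpt ((k : ℝ) • a) ∧ c.IsEndpt ((k : ℝ) • b) := by
  obtain ⟨x, i, hx, h⟩ := hab
  have hkx : inLat k ((k : ℝ) • x) := by
    simpa using inLat.smul (k := k) (inLat_one.2 hx)
  obtain ⟨c, hc, h1, h2⟩ := (hA.2.2.2.2.2.1 _ i hkx.latt hkx).1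
  rw [← smul_add] at h2
  rcases Sym2.eq_iff.1 h with ⟨rfl, rfl⟩ | ⟨rfl, rfl⟩
  · exact ⟨c, hc, h1, h2⟩
  · exact ⟨c, hc, h2, h1⟩

/-- Each curve of `A` has a translate in `A` by each vector of `l·ℤ^n`. -/
theorem exists_translate (hA : SatH A k l) {t : Pt n} (ht : inLat l t) {c : Curve n}
    (hc : c ∈ A) :
    ∃ d ∈ A, (∀ S ∈ c.segs, shift t S ∈ d.segs) ∧
      (∀ S T, c.conn S T → d.conn (shift t S) (shift t T)) ∧
      (∀ p S, c.endSegAt p S → d.endSegAt (p + t) (shift t S)) ∧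
      ∀ p, c.IsEndpt p → d.IsEndpt (p + t) := by
  have hD := hA.disjSA
  have hper := hA.2.2.2.2.2.2
  obtain ⟨i, hi, hi'⟩ := c.nontriv
  have hS₀ : s(c.v i, c.v (i + 1)) ∈ c.segs := ⟨i, hi, hi', rfl⟩
  obtain ⟨d, hd, hdS⟩ := hA.exists_curve_of_isSeg ((Curve.isSeg_of_mem hS₀).shift ht.latt)
  have hconn : ∀ S T, c.conn S T → shift t S ∈ d.segs → d.conn (shift t S) (shift t T) :=
    fun S T h hS => hD.conn_of_mem_segs hd hS
      (Trace.conn_shift_of_transl_eq (hper t ht) ⟨c, hc, h⟩)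
  have hsegs : ∀ S ∈ c.segs, shift t S ∈ d.segs :=
    Curve.forall_segs_of_conn (fun S T h hS => (hconn S T h hS).right_mem) hS₀ hdS
  have hend : ∀ p S, c.endSegAt p S → d.endSegAt (p + t) (shift t S) := by
    intro p S h
    rw [(hD.1 c hc).endSegAt_iff] at h
    obtain ⟨hS, hp, hT⟩ := h
    refine (hD.1 d hd).endSegAt_iff.2 ⟨hsegs S hS, mem_shift.2 (by simpa using hp), ?_⟩
    intro T hST hpT
    have h := Trace.conn_shift_of_transl_eq (hper (-t) ht.neg) ⟨d, hd, hST⟩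
    rw [shift_neg_shift] at h
    exact hT _ (hD.conn_of_mem_segs hc hS h) (mem_shift.2 (by simpa using hpT))
  refine ⟨d, hd, hsegs, fun S T h => hconn S T h (hsegs S h.left_mem), hend, fun p hp => ?_⟩
  obtain ⟨S, hS⟩ := Curve.isEndpt_iff_exists_endSegAt.1 hp
  exact (hend p S hS).isEndpt

end SatH

namespace PowersOf

variable {n : ℕ} {A : Set (Curve n)} {k l : ℕ} {P : ℕ → Set (Curve n)}

theorem mem_segs_iff (hP : PowersOf A k P) (hA : SatH A k l) (s : ℕ) {S : Sym2 (Pt n)} :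
    S ∈ (traceOf (P s)).segs ↔ IsSeg S := by
  refine ⟨fun ⟨c, _, h⟩ => Curve.isSeg_of_mem h, fun hS => ?_⟩
  induction s generalizing S with
  | zero => rw [hP.2.1]; exact hS
  | succ s ih =>
    rw [hP.2.2 s]
    obtain ⟨c, hc, hSc⟩ := hA.exists_curve_of_isSeg hS
    obtain ⟨a, b, hab, ha, hb, -⟩ := hA.exists_endpts hc
    exact ⟨a, b, ih hab, c, hc, ha, hb, hSc⟩

theorem conn_succ (hP : PowersOf A k P) (hA : SatH A k l) (s : ℕ) {S T : Sym2 (Pt n)}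
    (h : (traceOf (P s)).conn S T) : (traceOf (P (s + 1))).conn S T := by
  induction s generalizing S T with
  | zero => rw [hP.2.1] at h; exact h.elim
  | succ s ih =>
    rw [hP.2.2 s] at h
    rw [hP.2.2 (s + 1)]
    rcases h with ⟨a, b, hab, h⟩ | ⟨a, b, d, habd, h⟩
    · rw [hP.mem_segs_iff hA s] at hab
      exact Or.inl ⟨a, b, (hP.mem_segs_iff hA (s + 1)).2 hab, h⟩
    · exact Or.inr ⟨a, b, d, ih habd, h⟩

theorem conn_mono (hP : PowersOf A k P) (hA : SatH A k l) {s s' : ℕ} (hs : s ≤ s')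
    {S T : Sym2 (Pt n)} (h : (traceOf (P s)).conn S T) : (traceOf (P s')).conn S T := by
  induction s', hs using Nat.le_induction with
  | base => exact h
  | succ m _ ih => exact hP.conn_succ hA m ih

/-- The connexions of `A^s` are invariant under the translations of `l k^s ℤ^n`. -/
theorem conn_shift (hP : PowersOf A k P) (hA : SatH A k l) (s : ℕ) {t : Pt n}
    (ht : inLat (l * k ^ s) t) {S T : Sym2 (Pt n)} (h : (traceOf (P s)).conn S T) :
    (traceOf (P s)).conn (shift t S) (shift t T) := by
  induction s generalizing S T t with
  | zero => rw [hP.2.1] at h; exact h.elim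
  | succ s ih =>
    rw [hP.2.2 s] at h ⊢
    have htl : inLat l t := ht.of_dvd (Dvd.intro _ rfl)
    obtain ⟨u, hu, rfl⟩ := inLat.exists_smul (k := k) (m := l * k ^ s) hA.1
      (by rwa [pow_succ', mul_left_comm] at ht)
    rcases h with ⟨a, b, hab, c, hc, ha, hb, hST⟩ |
      ⟨a, b, e, habe, c, hc, c', hc', ha, hb, hb', he, hends⟩
    · obtain ⟨d, hd, -, hconn, -, hept⟩ := hA.exists_translate htl hc
      refine Or.inl ⟨a + u, b + u, ?_, d, hd, ?_, ?_, hconn S T hST⟩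
      · rw [hP.mem_segs_iff hA s] at hab ⊢
        exact hab.shift hu.latt
      · rw [smul_add]; exact hept _ ha
      · rw [smul_add]; exact hept _ hb
    · obtain ⟨d, hd, -, -, hseg, hept⟩ := hA.exists_translate htl hc
      obtain ⟨d', hd', -, -, hseg', hept'⟩ := hA.exists_translate htl hc'
      refine Or.inr ⟨a + u, b + u, e + u, ih hu habe, d, hd, d', hd', ?_⟩
      simp only [smul_add]
      exact ⟨hept _ ha, hept _ hb, hept' _ hb', hept' _ he,
        hends.imp (fun h => ⟨hseg _ _ h.1, hseg' _ _ h.2⟩)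
          (fun h => ⟨hseg _ _ h.1, hseg' _ _ h.2⟩)⟩

/-- Each segment of `A^s` is connected to another one at each of its endpoints which is not in
`k^s ℤ^n`. -/
theorem exists_conn (hP : PowersOf A k P) (hA : SatH A k l) (s : ℕ) {p : Pt n} (hp : latt p)
    (hps : ¬ inLat (k ^ s) p) {S : Sym2 (Pt n)} (hS : IsSeg S) (hpS : p ∈ S) :
    ∃ T, p ∈ T ∧ (traceOf (P s)).conn S T := by
  induction s generalizing S p with
  | zero => exact absurd (inLat_one.2 hp) (by simpa using hps)
  | succ s ih =>
    rw [hP.2.2 s]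
    obtain ⟨c, hc, hSc⟩ := hA.exists_curve_of_isSeg hS
    obtain ⟨a, b, hab, ha, hb, hends⟩ := hA.exists_endpts hc
    by_cases hcS : c.endSegAt p S
    · obtain ⟨q, q', hqq', hq, hq', rfl⟩ : ∃ q q', IsSeg s(q', q) ∧ c.IsEndpt ((k : ℝ) • q) ∧
          c.IsEndpt ((k : ℝ) • q') ∧ p = (k : ℝ) • q := by
        rcases hends p hcS.isEndpt with rfl | rfl
        · exact ⟨a, b, by rwa [Sym2.eq_swap], ha, hb, rfl⟩
        · exact ⟨b, a, hab, hb, ha, rfl⟩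
      have hqs : ¬ inLat (k ^ s) q := fun h => hps (by rw [pow_succ']; exact h.smul)
      have hql : latt q := by
        obtain ⟨x, i, hx, h⟩ := hqq'
        rcases Sym2.eq_iff.1 h with ⟨-, rfl⟩ | ⟨-, rfl⟩
        · exact hx.add (latt_uvec i)
        · exact hx
      obtain ⟨T, ⟨r, rfl⟩, hT⟩ := ih hql hqs hqq' (by simp)
      have hqr : IsSeg s(q, r) := by
        obtain ⟨d, -, hd⟩ := hT
        exact Curve.isSeg_of_mem hd.right_mem
      obtain ⟨c', hc', hq1, hr1⟩ := hA.exists_curve_of_endpts hqr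
      obtain ⟨T, hT'⟩ := Curve.isEndpt_iff_exists_endSegAt.1 hq1
      exact ⟨T, ((hA.disjSA.1 c' hc').endSegAt_iff.1 hT').2.1,
        Or.inr ⟨q', q, r, hT, c, hc, c', hc', hq', hq, hq1, hr1, Or.inl ⟨hcS, hT'⟩⟩⟩
    · rw [(hA.disjSA.1 c hc).endSegAt_iff] at hcS
      push Not at hcS
      obtain ⟨T, hT, hpT⟩ := hcS hSc hpS
      exact ⟨T, hpT, Or.inl ⟨a, b, (hP.mem_segs_iff hA s).2 hab, c, hc, ha, hb, hT⟩⟩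

theorem hat_conn_unique (hP : PowersOf A k P) (hA : SatH A k l) {S V W : Sym2 (Pt n)}
    {p : Pt n} (hV : (hatTrace P).conn S V) (hW : (hatTrace P).conn S W) (hpS : p ∈ S)
    (hpV : p ∈ V) (hpW : p ∈ W) : V = W := by
  obtain ⟨s, hV⟩ := hV
  obtain ⟨s', hW⟩ := hW
  exact (hP.1 (max s s')).conn_unique (hP.conn_mono hA (le_max_left s s') hV)
    (hP.conn_mono hA (le_max_right s s') hW) hpS hpV hpW

theorem hatR_mem_segs_iff (hP : PowersOf A k P) (hA : SatH A k l) {R : Pt n → Pt n → Prop}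
    {S : Sym2 (Pt n)} : S ∈ (hatRTrace P R).segs ↔ IsSeg S :=
  ⟨fun ⟨s, hs⟩ => (hP.mem_segs_iff hA s).1 hs, fun hS => ⟨0, (hP.mem_segs_iff hA 0).2 hS⟩⟩

end PowersOf

section Directions

variable {n : ℕ}

/-- The elements of `{e_1, -e_1, …, e_n, -e_n}`. -/
def dirVec (δ : Fin n × Bool) : Pt n := if δ.2 then uvec n δ.1 else -uvec n δ.1

theorem dirVec_ne_zero (δ : Fin n × Bool) : dirVec δ ≠ 0 := by
  unfold dirVec
  split_ifs
  · exact uvec_ne_zero _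
  · exact neg_ne_zero.2 (uvec_ne_zero _)

theorem dirVec_injective : Function.Injective (dirVec (n := n)) := by
  rintro ⟨i, b⟩ ⟨j, b'⟩ h
  have hi := congrArg (fun p : Pt n => p i) h
  by_cases hij : i = j
  · subst hij
    cases b <;> cases b' <;> simp [dirVec, uvec] at hi ⊢ <;> norm_num at hi
  · cases b <;> cases b' <;> simp [dirVec, uvec, hij] at hi

theorem isSeg_dirVec {p : Pt n} (hp : latt p) (δ : Fin n × Bool) :
    IsSeg s(p, p + dirVec δ) := by
  obtain ⟨i, b⟩ := δ
  cases b
  · exact ⟨p - uvec n i, i, hp.sub (latt_uvec i), by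
      simp [dirVec, Sym2.eq_swap, ← sub_eq_add_neg]⟩
  · exact ⟨p, i, hp, by simp [dirVec]⟩

theorem IsSeg.exists_dirVec {S : Sym2 (Pt n)} (hS : IsSeg S) {p : Pt n} (hp : p ∈ S) :
    ∃ δ, S = s(p, p + dirVec δ) := by
  obtain ⟨x, i, -, rfl⟩ := hS
  rcases Sym2.mem_iff.1 hp with rfl | rfl
  · exact ⟨(i, true), by simp [dirVec]⟩
  · exact ⟨(i, false), by simp [dirVec, Sym2.eq_swap]⟩

end Directions

namespace SatH

variable {n : ℕ} {A : Set (Curve n)} {k l : ℕ}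

/-- At a point of `k·ℤ^n`, each segment is the end segment of some curve of `A`. -/
theorem exists_endSegAt (hA : SatH A k l) {q : Pt n} (hq : latt q) {S : Sym2 (Pt n)}
    (hS : IsSeg S) (hqS : (k : ℝ) • q ∈ S) : ∃ c ∈ A, c.endSegAt ((k : ℝ) • q) S := by
  have hk : (k : ℝ) ≠ 0 := by exact_mod_cast hA.1.ne'
  choose c hcA hc1 hc2 using fun δ => hA.exists_curve_of_endpts (isSeg_dirVec hq δ)
  choose e he using fun δ => Curve.isEndpt_iff_exists_endSegAt.1 (hc1 δ)
  have he' := fun δ => (hA.disjSA.1 _ (hcA δ)).endSegAt_iff.1 (he δ)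
  choose f hf using fun δ => (Curve.isSeg_of_mem (he' δ).1).exists_dirVec (he' δ).2.1
  have hinj : Function.Injective f := by
    intro δ δ' hδ
    have hee : e δ = e δ' := by rw [hf δ, hf δ', hδ]
    have hsame := hA.disjSA.sameCurve (hcA δ') (hcA δ) (he' δ').1 (hee ▸ (he' δ).1)
    have h3 := hsame.isEndpt (hA.disjSA.1 _ (hcA δ')) (hA.disjSA.1 _ (hcA δ)) (hc2 δ')
    obtain ⟨a, b, -, -, -, hab⟩ := hA.exists_endpts (hcA δ)
    have h1 := hab _ (hc1 δ)
    have h2 := hab _ (hc2 δ)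
    have h3 := hab _ h3
    simp only [smul_right_inj hk] at h1 h2 h3
    have hne : ∀ ε : Fin n × Bool, q + dirVec ε ≠ q := fun ε => by simp [dirVec_ne_zero]
    have hthird : ∀ y z : Pt n, y ≠ q → z ≠ q → (y = a ∨ y = b) → (z = a ∨ z = b) → y = z := by
      clear * - h1
      grind
    exact dirVec_injective (add_left_cancel (hthird _ _ (hne δ) (hne δ') h2 h3))
  obtain ⟨ε, hε⟩ := hS.exists_dirVec hqS
  obtain ⟨δ, rfl⟩ := Finite.surjective_of_injective hinj ε
  refine ⟨c δ, hcA δ, ?_⟩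
  rw [hε, ← hf δ]
  exact he δ

theorem not_conn_of_one (hA : SatH A 1 l) (S T : Sym2 (Pt n)) : ¬ (traceOf A).conn S T := by
  rintro ⟨c, hc, h⟩
  obtain ⟨p, hp, hpS, hpT⟩ := h.exists_vertex
  obtain ⟨d, hd, hdS⟩ := hA.exists_endSegAt hp (Curve.isSeg_of_mem h.left_mem) (by simpa using hpS)
  rw [(hA.disjSA.1 d hd).endSegAt_iff, Nat.cast_one, one_smul] at hdS
  exact hdS.2.2 T (hA.disjSA.conn_of_mem_segs hd hdS.1 ⟨c, hc, h⟩) hpT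

end SatH

namespace PowersOf

variable {n : ℕ} {A : Set (Curve n)} {k l : ℕ} {P : ℕ → Set (Curve n)}

theorem not_conn_of_one (hP : PowersOf A 1 P) (hA : SatH A 1 l) (s : ℕ) (S T : Sym2 (Pt n)) :
    ¬ (traceOf (P s)).conn S T := by
  induction s generalizing S T with
  | zero => rw [hP.2.1]; exact id
  | succ s ih =>
    rw [hP.2.2 s]
    rintro (⟨a, b, -, c, hc, -, -, h⟩ | ⟨a, b, d, h, -⟩)
    · exact hA.not_conn_of_one S T ⟨c, hc, h⟩
    · exact ih _ _ h

end PowersOf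

section Cube

variable {n : ℕ}

theorem convex_cube (x : Pt n) (h : ℕ) : Convex ℝ (cube x h) := by
  intro p hp q hq a b ha hb hab i
  exact convex_Icc (x i - h) (x i + h) (hp i) (hq i) ha hb hab

theorem add_mem_cube {x p t : Pt n} {h : ℕ} : p + t ∈ cube (x + t) h ↔ p ∈ cube x h := by
  simp [cube, add_sub_right_comm, add_right_comm _ (t _)]

theorem mem_cube_comm {x y : Pt n} {h : ℕ} : x ∈ cube y h ↔ y ∈ cube x h := by
  refine forall_congr' fun i => ⟨fun h => ⟨?_, ?_⟩, fun h => ⟨?_, ?_⟩⟩ <;>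
    linarith [h.1, h.2]

theorem closedBall_subset_cube {x : Pt n} {r : ℝ} {h : ℕ} (hr : ‖x‖ + r ≤ h) :
    Metric.closedBall x r ⊆ cube 0 h := by
  intro p hp i
  have h1 : ‖p‖ ≤ h := by
    have := norm_le_norm_add_norm_sub' p x
    rw [mem_closedBall_iff_norm] at hp
    linarith
  have h2 := (PiLp.norm_apply_le p i).trans h1
  rw [Real.norm_eq_abs, abs_le] at h2
  simpa using h2

theorem IsDir.mem_cube {u : Pt n} (hu : IsDir u) : u ∈ cube 0 1 := by
  refine closedBall_subset_cube (x := 0) (r := 1) (by simp) ?_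
  obtain ⟨i, rfl | rfl⟩ := hu <;> simp [uvec]

/-- Condition (C) moves connexions in a cube centered at `0` to connexions in a cube avoiding
`0`. -/
theorem CondC.exists_translate {T : Trace n} (hC : CondC T) {h : ℕ} (hh : 1 ≤ h) :
    ∃ y, latt y ∧ 0 ∉ cube y h ∧ ∀ S S', segPts S ⊆ cube 0 h → segPts S' ⊆ cube 0 h →
      (T.conn S S' ↔ T.conn (shift y S) (shift y S')) := by
  obtain ⟨y, hy, hy0, hT⟩ := hC 0 h latt_zero hh
  rw [sub_zero] at hT
  refine ⟨y, hy, fun h => hy0 (mem_cube_comm.1 h), fun S S' hS hS' => ⟨fun hc => ?_, fun hc => ?_⟩⟩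
  · have : (T.restr (cube y h)).conn (shift y S) (shift y S') :=
      hT ▸ ⟨S, S', ⟨hc, hS, hS'⟩, rfl, rfl⟩
    exact this.1
  · have hsub : ∀ S, segPts S ⊆ cube 0 h → segPts (shift y S) ⊆ cube y h := by
      intro S hS q hq
      have := add_mem_cube (t := y).2 (hS (mem_segPts_shift.1 hq))
      simpa using this
    have : (T.restr (cube y h)).conn (shift y S) (shift y S') := ⟨hc, hsub S hS, hsub S' hS'⟩
    rw [← hT] at this
    obtain ⟨U, V, hUV, hU, hV⟩ := this
    have hinj := fun {X Y} (e : shift y X = shift y Y) => by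
      simpa only [shift_neg_shift] using congrArg (shift (-y)) e
    rw [hinj hU, hinj hV]
    exact hUV.1

end Cube

theorem PowersOf.not_condC_of_one {n l : ℕ} (hn : 2 ≤ n) {A : Set (Curve n)}
    (hA : SatH A 1 l) {P : ℕ → Set (Curve n)} (hP : PowersOf A 1 P) {R : Pt n → Pt n → Prop}
    (hR : IsPairing R) : ¬ CondC (hatRTrace P R) := by
  intro hC
  obtain ⟨y, -, hy0, hy⟩ := hC.exists_translate le_rfl
  obtain ⟨v, huv, -⟩ := hR.2.2.2 (uvec n ⟨0, by omega⟩) ⟨_, Or.inl rfl⟩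
  set u := uvec n ⟨0, by omega⟩
  have h0 : (0 : Pt n) ∈ cube 0 1 := by simp [cube]
  have hsub : ∀ {w : Pt n}, IsDir w → segPts s(0, w) ⊆ cube 0 1 := fun hw =>
    segPts_pair_subset_of_convex (convex_cube 0 1) h0 hw.mem_cube
  have hd := hR.2.1 u v huv
  rcases (hy _ _ (hsub hd.1) (hsub hd.2)).1 (Or.inr ⟨u, v, huv, rfl, rfl⟩) with
    ⟨s, h⟩ | ⟨u', v', -, h1, h2⟩
  · exact hP.not_conn_of_one hA s _ _ h
  · have hy : y ≠ 0 := by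
      rintro rfl
      exact hy0 h0
    have key : ∀ {w w' : Pt n}, shift y s(0, w) = s(0, w') → w + y = 0 := by
      intro w w' h
      have : (0 : Pt n) ∈ shift y s(0, w) := h ▸ Sym2.mem_mk_left _ _
      rcases Sym2.mem_iff.1 this with h | h
      · exact absurd (by simpa using h.symm) hy
      · exact h.symm
    have : u = v := add_right_cancel ((key h1).trans (key h2).symm)
    exact hR.2.2.1 u (by rwa [← this] at huv)

section LocalIsomorphism

variable {n : ℕ}

theorem segPts_shift_subset_closedBall {t x : Pt n} {r : ℝ} {S : Sym2 (Pt n)} :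
    segPts (shift t S) ⊆ Metric.closedBall (x + t) r ↔ segPts S ⊆ Metric.closedBall x r := by
  constructor
  · intro h q hq
    simpa [dist_eq_norm] using h (segPts_shift_of_mem (t := t) hq)
  · intro h q hq
    have := h (mem_segPts_shift.1 hq)
    rw [Metric.mem_closedBall, dist_eq_norm] at this ⊢
    rwa [← sub_sub, sub_right_comm]

theorem Trace.add_mem_pts {T : Trace n} (hT : ∀ S, S ∈ T.segs ↔ IsSeg S) {t q : Pt n}
    (ht : latt t) (hq : q ∈ T.pts) : q + t ∈ T.pts := by
  simp only [Trace.pts, mem_iUnion, hT] at hq ⊢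
  obtain ⟨S, hS, hq⟩ := hq
  exact ⟨shift t S, hS.shift ht, segPts_shift_of_mem hq⟩

/-- In a trace containing all the lattice segments, a lattice translation which preserves the
connexions in a ball is an isomorphism on this ball. -/
theorem ballIso_of_conn_iff {T : Trace n} (hT : ∀ S, S ∈ T.segs ↔ IsSeg S) {x t : Pt n}
    (ht : latt t) {r : ℝ}
    (h : ∀ S S', segPts S ⊆ Metric.closedBall x r → segPts S' ⊆ Metric.closedBall x r →
      (T.conn S S' ↔ T.conn (shift t S) (shift t S'))) :
    BallIso T x T (x + t) r := by
  have h1 : x + t - x = t := add_sub_cancel_left x t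
  have h2 : x - (x + t) = -t := by abel
  rw [BallIso, h1, h2]
  refine ⟨?_, fun S S' hc hS hS' => (h S S' hS hS').1 hc, fun S S' hc hS hS' => ?_⟩
  · ext q
    constructor
    · rintro ⟨p, ⟨hp, hpx⟩, rfl⟩
      exact ⟨Trace.add_mem_pts hT ht hp, by simpa [dist_eq_norm] using hpx⟩
    · rintro ⟨hq, hqx⟩
      refine ⟨q - t, ⟨?_, ?_⟩, sub_add_cancel q t⟩
      · rw [sub_eq_add_neg]
        exact Trace.add_mem_pts hT ht.neg hq
      · rw [Metric.mem_closedBall, dist_eq_norm] at hqx ⊢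
        rwa [sub_right_comm, sub_sub]
  · rw [← shift_shift_neg t S, segPts_shift_subset_closedBall] at hS
    rw [← shift_shift_neg t S', segPts_shift_subset_closedBall] at hS'
    rw [← shift_shift_neg t S, ← shift_shift_neg t S'] at hc
    exact (h _ _ hS hS').2 hc

theorem exists_inLat_mem_closedBall {m : ℕ} (hm : 0 < m) (x : Pt n) :
    ∃ t, inLat m t ∧ ‖x - t‖ ≤ √(∑ _i : Fin n, (m : ℝ) ^ 2) := by
  have hm' : (0 : ℝ) < m := by exact_mod_cast hm
  refine ⟨WithLp.toLp 2 fun i => (m : ℝ) * (⌊x i / m⌋ : ℝ), fun i => ⟨_, rfl⟩, ?_⟩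
  rw [EuclideanSpace.norm_eq]
  refine Real.sqrt_le_sqrt (Finset.sum_le_sum fun i _ => ?_)
  have h1 := Int.floor_le (x i / m)
  have h2 := Int.lt_floor_add_one (x i / m)
  rw [le_div_iff₀ hm'] at h1
  rw [div_lt_iff₀ hm'] at h2
  rw [Real.norm_eq_abs, sq_abs, PiLp.sub_apply]
  refine pow_le_pow_left₀ ?_ ?_ 2 <;> simp only <;> linarith

theorem exists_not_inLat_pow {k : ℕ} (hk : 2 ≤ k) {x : Pt n} {r : ℝ}
    (h0 : (0 : Pt n) ∉ Metric.closedBall x r) :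
    ∃ s, ∀ q ∈ Metric.closedBall x r, ¬ inLat (k ^ s) q := by
  obtain ⟨s, hs⟩ := pow_unbounded_of_one_lt (‖x‖ + r)
    (show (1 : ℝ) < k by exact_mod_cast hk)
  refine ⟨s, fun q hq hqs => h0 ?_⟩
  suffices q = 0 from this ▸ hq
  ext i
  obtain ⟨c, hc⟩ := hqs i
  have h1 : ‖q i‖ ≤ ‖x‖ + r := by
    refine (PiLp.norm_apply_le q i).trans ?_
    have := norm_le_norm_add_norm_sub' q x
    rw [mem_closedBall_iff_norm] at hq
    linarith
  rw [hc, norm_mul, Real.norm_natCast, Nat.cast_pow] at h1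
  have hpos : (0 : ℝ) < (k : ℝ) ^ s := by positivity
  have hc0 : c = 0 := by
    by_contra hne
    have : (1 : ℝ) ≤ ‖(c : ℝ)‖ := by
      rw [Real.norm_eq_abs]
      exact_mod_cast Int.one_le_abs hne
    nlinarith
  rw [hc, hc0]
  simp

end LocalIsomorphism

/-- In a ball without points of `k^s ℤ^n`, the connexions of `Â_R` are those of `A^s`, hence they
are preserved by the translations of `l k^s ℤ^n`. -/
theorem PowersOf.hatR_conn_shift_iff {n k l : ℕ} {A : Set (Curve n)} {P : ℕ → Set (Curve n)}
    (hP : PowersOf A k P) (hA : SatH A k l) {R : Pt n → Pt n → Prop} {x : Pt n} {r : ℝ}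
    {s : ℕ} (hs : ∀ q ∈ Metric.closedBall x r, ¬ inLat (k ^ s) q) {t : Pt n}
    (ht : inLat (l * k ^ s) t) {S S' : Sym2 (Pt n)} (hS : segPts S ⊆ Metric.closedBall x r) :
    (hatRTrace P R).conn S S' ↔ (hatRTrace P R).conn (shift t S) (shift t S') := by
  have htk : inLat (k ^ s) t := ht.of_dvd (Dvd.intro_left _ rfl)
  have key : ∀ {U V : Sym2 (Pt n)}, (hatTrace P).conn U V → segPts U ⊆ Metric.closedBall x r →
      (traceOf (P s)).conn U V := by
    rintro U V ⟨s', c, hc, hUV⟩ hU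
    obtain ⟨p, hp, hpU, hpV⟩ := hUV.exists_vertex
    obtain ⟨W, hpW, hW⟩ := hP.exists_conn hA s hp (hs p (hU (mem_segPts hpU)))
      (Curve.isSeg_of_mem hUV.left_mem) hpU
    rwa [hP.hat_conn_unique hA ⟨s', c, hc, hUV⟩ ⟨s, hW⟩ hpU hpV hpW]
  constructor
  · rintro (h | ⟨u, v, -, rfl, -⟩)
    · exact Or.inl ⟨s, hP.conn_shift hA s ht (key h hS)⟩
    · exact absurd (fun i => ⟨0, by simp⟩) (hs 0 (hS (mem_segPts (by simp))))
  · rintro (⟨s', c, hc, h⟩ | ⟨u, v, -, h, -⟩)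
    · obtain ⟨p, hp, hpS, hpS'⟩ := h.exists_vertex
      rw [mem_shift] at hpS hpS'
      have hseg := (Curve.isSeg_of_mem h.left_mem).shift ht.latt.neg
      rw [shift_neg_shift] at hseg
      obtain ⟨W, hpW, hW⟩ := hP.exists_conn hA s (hp.sub ht.latt)
        (hs _ (hS (mem_segPts hpS))) hseg hpS
      have hW' := hP.conn_shift hA s ht hW
      have := hP.hat_conn_unique hA ⟨s', c, hc, h⟩ ⟨s, hW'⟩ (mem_shift.2 hpS)
        (mem_shift.2 hpS') (mem_shift.2 hpW)
      have := congrArg (shift (-t)) this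
      rw [shift_neg_shift, shift_neg_shift] at this
      exact Or.inl ⟨s, this ▸ hW⟩
    · have h0 : (0 : Pt n) ∈ shift t S := h ▸ Sym2.mem_mk_left _ _
      rw [mem_shift, zero_sub] at h0
      exact absurd htk.neg (hs _ (hS (mem_segPts h0)))

/-- Proposition 1.1: for each `Â_R`, condition (C) implies the local
isomorphism property. -/
theorem statement3 {n : ℕ} (hn : 2 ≤ n) (A : Set (Curve n)) (k l : ℕ)
    (hA : SatH A k l) (P : ℕ → Set (Curve n)) (hP : PowersOf A k P)
    (R : Pt n → Pt n → Prop) (hR : IsPairing R)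
    (hC : CondC (hatRTrace P R)) : LocIsoProp (hatRTrace P R) := by
  have hT : ∀ S, S ∈ (hatRTrace P R).segs ↔ IsSeg S := fun S => hP.hatR_mem_segs_iff hA
  have hk : 2 ≤ k := by
    by_contra hlt
    obtain rfl : k = 1 := by have := hA.1; omega
    exact hP.not_condC_of_one hn hA hR hC
  intro x r hr
  obtain ⟨y, hy, hy0, hconn⟩ : ∃ y, latt y ∧ (0 : Pt n) ∉ Metric.closedBall (x + y) r ∧
      ∀ S S', segPts S ⊆ Metric.closedBall x r → segPts S' ⊆ Metric.closedBall x r →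
        ((hatRTrace P R).conn S S' ↔ (hatRTrace P R).conn (shift y S) (shift y S')) := by
    obtain ⟨h, hh⟩ := exists_nat_ge (max 1 (‖x‖ + r))
    have hball := closedBall_subset_cube ((le_max_right _ _).trans hh)
    obtain ⟨y, hy, hy0, hconn⟩ :=
      hC.exists_translate (h := h) (by exact_mod_cast (le_max_left _ _).trans hh)
    refine ⟨y, hy, fun h0 => hy0 ?_, fun S S' hS hS' =>
      hconn S S' (hS.trans hball) (hS'.trans hball)⟩
    have : -y ∈ Metric.closedBall x r := by
      rw [Metric.mem_closedBall, dist_eq_norm] at h0 ⊢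
      rwa [show -y - x = 0 - (x + y) by abel]
    simpa using add_mem_cube (t := y).2 (hball this)
  obtain ⟨s, hs⟩ := exists_not_inLat_pow hk hy0
  have hm : 0 < l * k ^ s := Nat.mul_pos hA.2.1 (Nat.pow_pos hA.1)
  refine ⟨_, Real.sqrt_nonneg (∑ _i : Fin n, ((l * k ^ s : ℕ) : ℝ) ^ 2), fun w => ?_⟩
  obtain ⟨t, ht, hwt⟩ := exists_inLat_mem_closedBall hm (w - (x + y))
  refine ⟨x + (y + t), ?_, ballIso_of_conn_iff hT (hy.add ht.latt) fun S S' hS hS' => ?_⟩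
  · rwa [Metric.mem_closedBall, dist_comm, dist_eq_norm, ← add_assoc, ← sub_sub]
  · rw [hconn S S' hS hS',
      hP.hatR_conn_shift_iff hA hs ht (segPts_shift_subset_closedBall.2 hS), shift_shift,
      shift_shift]

end
end Folding
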